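/- arXiv:1304.7965 — 2 statements merged into one kernel-verified Lean document; each statement's English description precedes it below -/
import Mathlib

section
/- Let n, m, l, d be positive integers, let g_1, …, g_m and h_1, …, h_l be convex polynomials on ℝ^n of degree at most d, and set A := {x ∈ ℝ^n : g_i(x) ≤ 0, i = 1, …, m} and B := {x ∈ ℝ^n : h_j(x) ≤ 0, j = 1, …, l}; assume A and B are nonempty (A ∩ B may be empty). Let v := P_{B−A}(0), the nearest point of the closed convex set B − A to the origin. Let b_0 ∈ ℝ^n and define a_{k+1} := P_A(b_k) and b_{k+1} := P_B(a_{k+1}) for k ≥ 0. Then (a_k) converges to some ã ∈ A and (b_k) converges to some b̃ ∈ B with b̃ − ã = v, and there exist M > 0 and r_0 ∈ (0, 1) such that for all k ≥ 1: if d > 1 then ‖a_k − ã‖ ≤ M·k^{−ρ} and ‖b_k − b̃‖ ≤ M·k^{−ρ}, and if d = 1 then ‖a_k − ã‖ ≤ M·r_0^k and ‖b_k − b̃‖ ≤ M·r_0^k, where ρ := 1/min{(2d−1)^n − 1, 2·β(n−1)·d^n − 2}. -/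
open Metric Set Filter
open scoped BigOperators Pointwise

noncomputable section

/-- The restriction of `f` to every line is a polynomial of degree at most `d`. -/
def PolynomialOnLines {E : Type} [AddCommGroup E] [Module ℝ E] (d : ℕ) (f : E → ℝ) : Prop :=
  ∀ x y : E, ∃ p : Polynomial ℝ, p.natDegree ≤ d ∧ ∀ t : ℝ, f (x + t • y) = p.eval t

/-- A polynomial bounded by `M` on `[0, t]` is at most of order `(R / t) ^ d * M` at `R ≥ t`. -/
theorem Polynomial.abs_eval_le_of_abs_eval_le {d : ℕ} (hd : 0 < d) (p : Polynomial ℝ)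
    (hp : p.natDegree ≤ d) {t R M : ℝ} (ht : 0 < t) (htR : t ≤ R)
    (hM : ∀ s, 0 ≤ s → s ≤ t → |p.eval s| ≤ M) :
    |p.eval R| ≤ ((d + 1) * (d : ℝ) ^ d) * ((R / t) ^ d * M) := by
  have hd' : (0 : ℝ) < d := by exact_mod_cast hd
  set v : ℕ → ℝ := fun i => t * i / d with hv
  have hM0 : 0 ≤ M := (abs_nonneg _).trans (hM 0 le_rfl ht.le)
  have hinj : Set.InjOn v (Finset.range (d + 1) : Set ℕ) := by
    intro i _ j _ hij
    simp only [hv] at hij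
    field_simp at hij
    exact_mod_cast hij
  have hdeg : p.degree < (Finset.range (d + 1)).card := by
    rw [Finset.card_range]
    refine lt_of_le_of_lt Polynomial.degree_le_natDegree ?_
    exact_mod_cast Nat.lt_succ_of_le hp
  have heq := Lagrange.eq_interpolate (s := Finset.range (d + 1)) hinj hdeg
  have hmem : ∀ i ∈ Finset.range (d + 1), 0 ≤ v i ∧ v i ≤ t := by
    intro i hi
    have : (i : ℝ) ≤ d := by exact_mod_cast Nat.lt_succ_iff.mp (Finset.mem_range.mp hi)
    refine ⟨by positivity, ?_⟩
    simp only [hv]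
    rw [div_le_iff₀ hd']
    gcongr
  have hbasis : ∀ i ∈ Finset.range (d + 1),
      |(Lagrange.basis (Finset.range (d + 1)) v i).eval R| ≤ (d : ℝ) ^ d * (R / t) ^ d := by
    intro i hi
    rw [Lagrange.basis, Polynomial.eval_prod, Finset.abs_prod, ← mul_pow]
    have hcard : ((Finset.range (d + 1)).erase i).card = d := by
      rw [Finset.card_erase_of_mem hi, Finset.card_range]; rfl
    calc _ ≤ ∏ _j ∈ (Finset.range (d + 1)).erase i, ((d : ℝ) * (R / t)) := by
          refine Finset.prod_le_prod (fun _ _ => abs_nonneg _) fun j hj => ?_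
          obtain ⟨hji, hj⟩ := Finset.mem_erase.mp hj
          rw [Lagrange.basisDivisor, Polynomial.eval_mul, Polynomial.eval_C, Polynomial.eval_sub,
            Polynomial.eval_X, Polynomial.eval_C, abs_mul, abs_inv]
          have h1 : |R - v j| ≤ R := by
            have := hmem j hj
            rw [abs_le]; constructor <;> linarith
          have h2 : t / d ≤ |v i - v j| := by
            have h3 : v i - v j = t / d * ((i : ℤ) - (j : ℤ) : ℤ) := by
              simp only [hv]; push_cast; ring
            rw [h3, abs_mul, abs_of_pos (by positivity : 0 < t / d)]
            have : (1 : ℤ) ≤ |(i : ℤ) - j| := Int.one_le_abs (by omega)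
            have : (1 : ℝ) ≤ |(((i : ℤ) - j : ℤ) : ℝ)| := by exact_mod_cast this
            nlinarith [show 0 < t / d by positivity]
          calc |v i - v j|⁻¹ * |R - v j| ≤ (t / d)⁻¹ * R := by
                gcongr
            _ = d * (R / t) := by field_simp
      _ = _ := by rw [Finset.prod_const, hcard]
  rw [heq, Lagrange.interpolate_apply, Polynomial.eval_finsetSum]
  calc _ ≤ ∑ i ∈ Finset.range (d + 1), M * ((d : ℝ) ^ d * (R / t) ^ d) := by
        refine (Finset.abs_sum_le_sum_abs _ _).trans (Finset.sum_le_sum fun i hi => ?_)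
        rw [Polynomial.eval_mul, Polynomial.eval_C, abs_mul]
        exact mul_le_mul (hM _ (hmem i hi).1 (hmem i hi).2) (hbasis i hi) (abs_nonneg _) hM0
    _ = _ := by
        rw [Finset.sum_const, Finset.card_range, nsmul_eq_mul]; push_cast; ring

theorem PolynomialOnLines.of_mvPolynomial {n d : ℕ} {f : EuclideanSpace ℝ (Fin n) → ℝ}
    (p : MvPolynomial (Fin n) ℝ) (hp : p.totalDegree ≤ d)
    (hf : ∀ x : EuclideanSpace ℝ (Fin n), f x = MvPolynomial.eval (fun t => x t) p) :
    PolynomialOnLines d f := by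
  intro x y
  refine ⟨MvPolynomial.aeval (fun i => Polynomial.C (y i) * Polynomial.X + Polynomial.C (x i)) p,
    ?_, fun t => ?_⟩
  · have := MvPolynomial.aeval_natDegree_le (n := 1) p hp
      (fun i => Polynomial.C (y i) * Polynomial.X + Polynomial.C (x i))
      (fun i => Polynomial.natDegree_linear_le)
    simpa using this
  · rw [hf, ← Polynomial.coe_evalRingHom, MvPolynomial.aeval_def, MvPolynomial.hom_eval₂]
    rw [MvPolynomial.eval, MvPolynomial.coe_eval₂Hom]
    congr 1
    · ext r; simp
    · ext i; simp; ring

theorem PolynomialOnLines.comp_add {E : Type} [AddCommGroup E] [Module ℝ E] {d : ℕ} {f : E → ℝ}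
    (hf : PolynomialOnLines d f) (s : E) : PolynomialOnLines d fun x => f (x + s) := by
  intro x y
  obtain ⟨p, hp, h⟩ := hf (x + s) y
  exact ⟨p, hp, fun t => by rw [← h, add_right_comm]⟩

theorem PolynomialOnLines.comp_subtype {E : Type} [AddCommGroup E] [Module ℝ E] {d : ℕ}
    {f : E → ℝ} (hf : PolynomialOnLines d f) (W : Submodule ℝ E) :
    PolynomialOnLines d fun x : W => f x := by
  intro x y
  exact hf x y

theorem PolynomialOnLines.sum_mul {E ι : Type} [AddCommGroup E] [Module ℝ E] [Fintype ι] {d : ℕ}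
    {f : ι → E → ℝ} (hf : ∀ i, PolynomialOnLines d (f i)) (c : ι → ℝ) :
    PolynomialOnLines d fun x => ∑ i, c i * f i x := by
  intro x y
  choose p hp h using fun i => hf i x y
  refine ⟨∑ i, Polynomial.C (c i) * p i, Polynomial.natDegree_sum_le_of_forall_le _ _ fun i _ =>
    (Polynomial.natDegree_C_mul_le _ _).trans (hp i), fun t => ?_⟩
  simp [Polynomial.eval_finsetSum, h]

/-- If `φ` is polynomial on lines and `|φ|` is convex, the zero set of `φ` is a subspace as soon
as it contains the origin. -/
theorem PolynomialOnLines.exists_submodule_eq_zero {E : Type} [AddCommGroup E] [Module ℝ E] {d : ℕ}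
    {φ : E → ℝ} (hφ : PolynomialOnLines d φ) (hconv : ConvexOn ℝ univ fun x => |φ x|)
    (h0 : φ 0 = 0) : ∃ Z : Submodule ℝ E, ∀ x, x ∈ Z ↔ φ x = 0 := by
  have hcomb : ∀ x y, φ x = 0 → φ y = 0 → ∀ s : ℝ, 0 ≤ s → s ≤ 1 →
      φ ((1 - s) • x + s • y) = 0 := by
    intro x y hx hy s hs hs1
    have := hconv.2 (mem_univ x) (mem_univ y) (sub_nonneg.mpr hs1) hs (by ring)
    simp only [hx, hy, abs_zero, smul_zero, add_zero] at this
    exact abs_nonpos_iff.mp this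
  have hsmul : ∀ x, φ x = 0 → ∀ t : ℝ, φ (t • x) = 0 := by
    intro x hx t
    obtain ⟨p, -, h⟩ := hφ 0 x
    simp only [zero_add] at h
    have hp : p = 0 := by
      refine Polynomial.eq_zero_of_infinite_isRoot p ((Set.Icc_infinite zero_lt_one).mono ?_)
      intro s hs
      have := hcomb 0 x h0 hx s hs.1 hs.2
      rw [smul_zero, zero_add, h] at this
      exact this
    rw [h, hp, Polynomial.eval_zero]
  refine ⟨{ carrier := {x | φ x = 0}, zero_mem' := h0, add_mem' := ?_, smul_mem' := ?_ },
    fun x => Iff.rfl⟩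
  · intro x y hx hy
    have := hcomb _ _ (hsmul x hx 2) (hsmul y hy 2) (1 / 2) (by norm_num) (by norm_num)
    rw [smul_smul, smul_smul] at this
    norm_num at this
    exact this
  · intro c x hx
    exact hsmul x hx c

/-- Growth of `|φ|` away from the zero set of `φ`. -/
theorem PolynomialOnLines.norm_sub_pow_le {E : Type} [NormedAddCommGroup E] [InnerProductSpace ℝ E]
    [FiniteDimensional ℝ E] {d : ℕ} (hd : 0 < d) {φ : E → ℝ} (hφ : PolynomialOnLines d φ)
    (hconv : ConvexOn ℝ univ fun x => |φ x|) (Z : Submodule ℝ E) (hZ : ∀ x, x ∈ Z ↔ φ x = 0)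
    {R : ℝ} (hR : 0 < R) :
    ∃ C > 0, ∀ x, ‖x‖ ≤ R → ‖x - Z.starProjection x‖ ^ d ≤ C * |φ x| := by
  have hcont : Continuous fun x => |φ x| := hconv.locallyLipschitz.continuous
  set K : Set E := {y | ‖y‖ ≤ 2 * R ∧ ‖y - Z.starProjection y‖ = R} with hK
  have hKc : IsCompact K := by
    refine (isCompact_closedBall (0 : E) (2 * R)).of_isClosed_subset ?_ fun y hy => by
      simpa using hy.1
    exact (isClosed_le continuous_norm continuous_const).inter
      (isClosed_eq (by fun_prop) continuous_const)
  obtain ⟨c, hc, hcK⟩ := hKc.exists_forall_le' hcont.continuousOn (a := 0) (by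
    rintro y ⟨-, hy⟩
    refine abs_pos.mpr fun h => ?_
    rw [Submodule.starProjection_eq_self_iff.mpr ((hZ y).mpr h), sub_self, norm_zero] at hy
    exact hR.ne hy)
  refine ⟨((d + 1) * (d : ℝ) ^ d) * R ^ d / c, by positivity, fun x hx => ?_⟩
  set w := Z.starProjection x with hw
  have hwZ : w ∈ Z := Submodule.starProjection_apply_mem Z x
  have hzo : x - w ∈ Zᗮ := Submodule.sub_starProjection_mem_orthogonal x
  have hzn : ‖x - w‖ ≤ R := by
    have h1 := Submodule.norm_sq_eq_add_norm_sq_starProjection x Z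
    rw [Submodule.starProjection_orthogonal_val, ← hw] at h1
    have : ‖x - w‖ ^ 2 ≤ ‖x‖ ^ 2 := by nlinarith [sq_nonneg ‖w‖]
    exact (abs_le_of_sq_le_sq' this (norm_nonneg _)).2.trans hx
  rcases eq_or_lt_of_le (norm_nonneg (x - w)) with h0 | hpos
  · rw [← h0, zero_pow hd.ne']; positivity
  set t := ‖x - w‖ with ht
  obtain ⟨p, hpd, hp⟩ := hφ w (t⁻¹ • (x - w))
  have hpt : p.eval t = φ x := by
    rw [← hp, smul_smul, mul_inv_cancel₀ hpos.ne', one_smul, add_sub_cancel]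
  have hmono : ∀ s, 0 ≤ s → s ≤ t → |p.eval s| ≤ |φ x| := by
    intro s hs hst
    have h1 : 0 ≤ s / t := by positivity
    have h2 : s / t ≤ 1 := (div_le_one hpos).mpr hst
    have := hconv.2 (mem_univ w) (mem_univ x) (sub_nonneg.mpr h2) h1 (by ring)
    simp only [(hZ w).mp hwZ, abs_zero, smul_eq_mul] at this
    rw [← hp]
    have h3 : w + s • t⁻¹ • (x - w) = (1 - s / t) • w + (s / t) • x := by
      rw [smul_smul, ← div_eq_mul_inv]; module
    rw [h3]
    nlinarith [abs_nonneg (φ x)]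
  have hmain := p.abs_eval_le_of_abs_eval_le hd hpd hpos hzn hmono
  have hy : w + R • t⁻¹ • (x - w) ∈ K := by
    have hn : ‖R • t⁻¹ • (x - w)‖ = R := by
      rw [norm_smul, norm_smul, norm_inv, Real.norm_of_nonneg hR.le, Real.norm_of_nonneg hpos.le,
        ← ht, inv_mul_cancel₀ hpos.ne', mul_one]
    have hP : Z.starProjection (w + R • t⁻¹ • (x - w)) = w :=
      Submodule.eq_starProjection_of_mem_orthogonal hwZ (by
        rw [add_sub_cancel_left]; exact Submodule.smul_mem _ _ (Submodule.smul_mem _ _ hzo))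
    refine ⟨(norm_add_le _ _).trans ?_, by rw [hP, add_sub_cancel_left, hn]⟩
    rw [hn]
    have : ‖w‖ ≤ ‖x‖ := Submodule.norm_starProjection_apply_le Z x
    linarith
  have hcR := hcK _ hy
  rw [hp] at hcR
  have := hcR.trans hmain
  rw [div_pow] at this
  have htd : 0 < t ^ d := by positivity
  rw [div_mul_eq_mul_div, le_div_iff₀ hc]
  calc t ^ d * c ≤ t ^ d * ((d + 1) * (d : ℝ) ^ d * (R ^ d / t ^ d * |φ x|)) := by gcongr
    _ = _ := by field_simp

/-- Convex functions without a common strict sublevel point admit nonnegative multipliers, not all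
zero, whose combination is nonnegative. -/
theorem ConvexOn.exists_multipliers {E ι : Type} [AddCommGroup E] [Module ℝ E] [Fintype ι]
    {f : ι → E → ℝ} (hf : ∀ i, ConvexOn ℝ univ (f i)) (hno : ¬∃ x, ∀ i, f i x < 0) :
    ∃ c : ι → ℝ, (∀ i, 0 ≤ c i) ∧ (∃ i, 0 < c i) ∧ ∀ x, 0 ≤ ∑ i, c i * f i x := by
  classical
  set U : Set (ι → ℝ) := {y | ∃ x, ∀ i, f i x < y i} with hU
  have hUc : Convex ℝ U := by
    rintro y ⟨x, hx⟩ y' ⟨x', hx'⟩ s t hs ht hst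
    refine ⟨s • x + t • x', fun i => ?_⟩
    refine ((hf i).2 (mem_univ _) (mem_univ _) hs ht hst).trans_lt ?_
    simp only [Pi.add_apply, Pi.smul_apply, smul_eq_mul]
    rcases eq_or_lt_of_le hs with rfl | hs'
    · have : t = 1 := by linarith
      subst this; simpa using hx' i
    · have h1 := mul_lt_mul_of_pos_left (hx i) hs'
      have h2 := mul_le_mul_of_nonneg_left (hx' i).le ht
      linarith
  have hUo : IsOpen U := by
    have : U = ⋃ x, Set.pi univ fun i => Ioi (f i x) := by
      ext y; simp [hU]
    rw [this]
    exact isOpen_iUnion fun x => isOpen_set_pi finite_univ fun i _ => isOpen_Ioi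
  have h0 : (0 : ι → ℝ) ∉ U := by
    rintro ⟨x, hx⟩
    exact hno ⟨x, hx⟩
  obtain ⟨φ, hφ⟩ := geometric_hahn_banach_point_open hUc hUo h0
  simp only [map_zero] at hφ
  have hrep : ∀ y : ι → ℝ, φ y = ∑ i, φ (Pi.single i 1) * y i := by
    intro y
    conv_lhs => rw [pi_eq_sum_univ' y]
    simp [map_sum, mul_comm]
  have hmem : (fun i => f i 0 + 1) ∈ U := ⟨0, fun i => by simp⟩
  have hnn : ∀ i, 0 ≤ φ (Pi.single i 1) := by
    intro i
    by_contra! hneg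
    set b : ι → ℝ := fun i => f i 0 + 1
    have hb := hφ b hmem
    have hs : 0 ≤ φ b / (-φ (Pi.single i 1)) := div_nonneg hb.le (by linarith)
    have := hφ (b + (φ b / (-φ (Pi.single i 1))) • Pi.single i 1) ⟨0, fun j => by
      have : (0 : ℝ) ≤ (Pi.single i 1 : ι → ℝ) j := by
        by_cases hij : j = i
        · subst hij; simp
        · simp [hij]
      simp only [b, Pi.add_apply, Pi.smul_apply, smul_eq_mul]
      have := mul_nonneg hs this
      linarith⟩
    rw [map_add, map_smul, smul_eq_mul] at this
    have h2 : φ b / (-φ (Pi.single i 1)) * φ (Pi.single i 1) = -φ b := by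
      have := hneg.ne
      field_simp
    rw [h2] at this
    linarith
  refine ⟨fun i => φ (Pi.single i 1), hnn, ?_, fun x => ?_⟩
  · by_contra! hall
    have h1 := hφ _ hmem
    rw [hrep, Finset.sum_eq_zero fun i _ => by rw [le_antisymm (hall i) (hnn i), zero_mul]] at h1
    exact lt_irrefl _ h1
  · refine le_of_forall_pos_lt_add fun ε hε => ?_
    set S := ∑ i, φ (Pi.single i 1) with hS
    have hS0 : 0 ≤ S := Finset.sum_nonneg fun i _ => hnn i
    have h1 := hφ (fun i => f i x + ε / (S + 1)) ⟨x, fun i => by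
      have : 0 < ε / (S + 1) := by positivity
      linarith⟩
    rw [hrep] at h1
    simp only [mul_add, Finset.sum_add_distrib, ← Finset.sum_mul] at h1
    refine h1.trans_le ?_
    gcongr
    rw [← hS, ← mul_div_assoc, div_le_iff₀ (by positivity)]
    nlinarith

/-- If a family of convex functions, polynomial on lines, has a common sublevel point at the origin
and none of them is everywhere nonpositive, then either Slater's condition holds, or some nonzero
function `φ`, polynomial on lines and with `|φ|` convex, satisfies `|φ| ≤ C * ε` wherever the family
is bounded above by `ε ≥ 0`. -/
theorem ConvexOn.slater_or_exists {E ι : Type} [AddCommGroup E] [Module ℝ E] [Fintype ι] {d : ℕ}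
    {f : ι → E → ℝ} (hf : ∀ i, ConvexOn ℝ univ (f i)) (hp : ∀ i, PolynomialOnLines d (f i))
    (hpos : ∀ i, ∃ x, 0 < f i x) :
    (∃ x, ∀ i, f i x < 0) ∨ ∃ φ : E → ℝ, PolynomialOnLines d φ ∧
      (ConvexOn ℝ univ fun x => |φ x|) ∧ (∃ x, φ x ≠ 0) ∧
      ∃ C > 0, ∀ x, ∀ ε ≥ 0, (∀ i, f i x ≤ ε) → |φ x| ≤ C * ε := by
  classical
  by_cases hno : ∃ x, ∀ i, f i x < 0
  · exact Or.inl hno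
  right
  obtain ⟨c, hc, ⟨i, hi⟩, hF⟩ := ConvexOn.exists_multipliers hf hno
  by_cases hF0 : ∃ x, ∑ i, c i * f i x ≠ 0
  · refine ⟨fun x => ∑ i, c i * f i x, PolynomialOnLines.sum_mul hp c, ?_, hF0, ∑ i, c i, ?_,
      fun x ε hε hx => ?_⟩
    · simp only [abs_of_nonneg (hF _)]
      refine ⟨convex_univ, fun x _ y _ s t hs ht hst => ?_⟩
      simp only [smul_eq_mul, Finset.mul_sum, ← Finset.sum_add_distrib]
      refine Finset.sum_le_sum fun j _ => ?_
      have := mul_le_mul_of_nonneg_left ((hf j).2 (mem_univ x) (mem_univ y) hs ht hst) (hc j)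
      simp only [smul_eq_mul] at this
      linarith
    · exact hi.trans_le (Finset.single_le_sum (f := c) (fun j _ => hc j) (Finset.mem_univ i))
    · rw [abs_of_nonneg (hF x), Finset.sum_mul]
      exact Finset.sum_le_sum fun j _ => mul_le_mul_of_nonneg_left (hx j) (hc j)
  · push Not at hF0
    have hneg : ∀ x, -f i x = (c i)⁻¹ * ∑ j ∈ Finset.univ.erase i, c j * f j x := by
      intro x
      have := hF0 x
      rw [← Finset.add_sum_erase _ _ (Finset.mem_univ i)] at this
      rw [eq_inv_mul_iff_mul_eq₀ hi.ne']
      linarith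
    have hnc : ConvexOn ℝ univ fun x => -f i x := by
      refine ⟨convex_univ, fun x _ y _ s t hs ht hst => ?_⟩
      simp only [hneg, smul_eq_mul, Finset.mul_sum, ← Finset.sum_add_distrib]
      refine Finset.sum_le_sum fun j _ => ?_
      have := mul_le_mul_of_nonneg_left ((hf j).2 (mem_univ x) (mem_univ y) hs ht hst)
        (mul_nonneg (inv_nonneg.mpr hi.le) (hc j))
      simp only [smul_eq_mul] at this
      linarith
    refine ⟨f i, hp i, (hf i).sup hnc, (hpos i).imp fun x hx => hx.ne',
      1 + (c i)⁻¹ * ∑ j ∈ Finset.univ.erase i, c j, ?_, fun x ε hε hx => ?_⟩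
    · have : 0 ≤ ∑ j ∈ Finset.univ.erase i, c j := Finset.sum_nonneg fun j _ => hc j
      positivity
    · have h0 : 0 ≤ (c i)⁻¹ * ∑ j ∈ Finset.univ.erase i, c j :=
        mul_nonneg (inv_nonneg.mpr hi.le) (Finset.sum_nonneg fun j _ => hc j)
      rw [abs_le']
      refine ⟨by nlinarith [hx i], ?_⟩
      rw [hneg]
      have : ∑ j ∈ Finset.univ.erase i, c j * f j x ≤ (∑ j ∈ Finset.univ.erase i, c j) * ε := by
        rw [Finset.sum_mul]
        exact Finset.sum_le_sum fun j _ => mul_le_mul_of_nonneg_left (hx j) (hc j)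
      calc _ ≤ (c i)⁻¹ * ((∑ j ∈ Finset.univ.erase i, c j) * ε) := by gcongr
        _ ≤ _ := by linarith

theorem ConvexOn.exists_lipschitz_closedBall {E ι : Type} [NormedAddCommGroup E]
    [NormedSpace ℝ E] [FiniteDimensional ℝ E] [Fintype ι] {f : ι → E → ℝ}
    (hf : ∀ i, ConvexOn ℝ univ (f i)) (R : ℝ) :
    ∃ L > 0, ∀ i x y, ‖x‖ ≤ R → ‖y‖ ≤ R → f i x ≤ f i y + L * ‖x - y‖ := by
  choose K hK using fun i => LocallyLipschitzOn.exists_lipschitzOnWith_of_compact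
    (isCompact_closedBall (0 : E) R) ((hf i).locallyLipschitz.locallyLipschitzOn (s := _))
  have hsum : (0 : ℝ) ≤ ∑ j, (K j : ℝ) := Finset.sum_nonneg fun j _ => (K j).2
  refine ⟨1 + ∑ i, (K i : ℝ), by positivity, fun i x y hx hy => ?_⟩
  have h1 := (hK i).dist_le_mul x (by simpa using hx) y (by simpa using hy)
  rw [Real.dist_eq, dist_eq_norm] at h1
  have h2 : (K i : ℝ) ≤ ∑ j, (K j : ℝ) :=
    Finset.single_le_sum (f := fun j => (K j : ℝ)) (fun j _ => (K j).2) (Finset.mem_univ i)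
  have h3 := (abs_le.mp h1).2
  nlinarith [norm_nonneg (x - y)]

/-- Local Hölder error bound, with exponent `d ^ N`, for a system of convex inequalities of degree
at most `d` in dimension at most `N`. -/
theorem ConvexOn.exists_holder_error_bound {d : ℕ} (hd : 0 < d) (N : ℕ) :
    ∀ (E : Type) [NormedAddCommGroup E] [InnerProductSpace ℝ E] [FiniteDimensional ℝ E],
    Module.finrank ℝ E ≤ N → ∀ (ι : Type) [Fintype ι] (f : ι → E → ℝ),
    (∀ i, ConvexOn ℝ univ (f i)) → (∀ i, PolynomialOnLines d (f i)) → (∀ i, f i 0 ≤ 0) →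
    ∀ R > 0, ∃ C > 0, ∀ x ε, ‖x‖ ≤ R → 0 ≤ ε → ε ≤ R → (∀ i, f i x ≤ ε) →
      ∃ y, (∀ i, f i y ≤ 0) ∧ ‖x - y‖ ^ d ^ N ≤ C * ε := by
  classical
  induction N with
  | zero =>
    intro E _ _ _ hE ι _ f hf hp h0 R hR
    have : Subsingleton E := Module.finrank_zero_iff.mp (Nat.le_zero.mp hE)
    refine ⟨1, one_pos, fun x ε _ hε _ _ => ⟨0, h0, ?_⟩⟩
    rw [Subsingleton.elim x 0]; simpa using hε
  | succ N ih =>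
    intro E _ _ _ hE ι _ f hf hp h0 R hR
    set D := d ^ (N + 1) with hD
    have hD0 : D ≠ 0 := (pow_pos hd _).ne'
    rcases ConvexOn.slater_or_exists (ι := {i // ∃ x, 0 < f i x}) (fun i => hf i) (fun i => hp i)
      (fun i => i.2) with ⟨x₀, hx₀⟩ | ⟨φ, hφp, hφc, ⟨x₁, hx₁⟩, C, hC, hφ⟩
    · obtain ⟨δ, hδ, hδx⟩ : ∃ δ > 0, ∀ i : {i // ∃ x, 0 < f i x}, f i x₀ ≤ -δ := by
        obtain ⟨δ, hδ, h⟩ := (Set.toFinite (range fun i : {i // ∃ x, 0 < f i x} =>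
          -f i x₀)).isCompact.exists_forall_le' (f := id) continuousOn_id (a := 0) (by
            rintro _ ⟨i, rfl⟩; simpa using hx₀ i)
        exact ⟨δ, hδ, fun i => by have := h _ ⟨i, rfl⟩; simp only [id] at this; linarith⟩
      set Q := R + ‖x₀‖ with hQ
      have hQ0 : 0 < Q := by positivity
      refine ⟨Q ^ D / δ, by positivity, fun x ε hx hε hεR hfx => ?_⟩
      set s := ε / (ε + δ) with hs
      have hεδ : 0 < ε + δ := by positivity
      have hs0 : 0 ≤ s := by positivity
      have hs1 : s ≤ 1 := by rw [hs, div_le_one hεδ]; linarith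
      refine ⟨(1 - s) • x + s • x₀, fun i => ?_, ?_⟩
      · by_cases hi : ∃ x, 0 < f i x
        · have h1 := (hf i).2 (mem_univ x) (mem_univ x₀) (sub_nonneg.mpr hs1) hs0 (by ring)
          refine h1.trans ?_
          simp only [smul_eq_mul]
          have h2 : f i x₀ ≤ -δ := hδx ⟨i, hi⟩
          have h3 := mul_le_mul_of_nonneg_left (hfx i) (sub_nonneg.mpr hs1)
          have h4 := mul_le_mul_of_nonneg_left h2 hs0
          have h5 : (1 - s) * ε + s * (-δ) = 0 := by rw [hs]; field_simp; ring
          linarith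
        · push Not at hi
          exact hi _
      · have h1 : x - ((1 - s) • x + s • x₀) = s • (x - x₀) := by module
        rw [h1, norm_smul, Real.norm_of_nonneg hs0, mul_pow]
        have h2 : ‖x - x₀‖ ≤ Q := (norm_sub_le _ _).trans (by linarith)
        have h3 : s ^ D ≤ s := pow_le_of_le_one hs0 hs1 hD0
        have h4 : s ≤ ε / δ := by rw [hs]; gcongr; linarith
        calc s ^ D * ‖x - x₀‖ ^ D ≤ (ε / δ) * Q ^ D := by gcongr; exact h3.trans h4
          _ = _ := by ring
    · have hφ' : ∀ x, ∀ ε ≥ 0, (∀ i, f i x ≤ ε) → |φ x| ≤ C * ε := fun x ε hε h =>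
        hφ x ε hε fun i => h i
      have hS : ∀ y, (∀ i, f i y ≤ 0) → φ y = 0 := fun y hy => by
        have := hφ' y 0 le_rfl hy
        rw [mul_zero] at this
        exact abs_nonpos_iff.mp this
      obtain ⟨Z, hZ⟩ := hφp.exists_submodule_eq_zero hφc (hS 0 h0)
      have hZlt : Module.finrank ℝ Z ≤ N := by
        have : Z < ⊤ := lt_top_iff_ne_top.mpr fun h => hx₁ ((hZ x₁).mp (h ▸ Submodule.mem_top))
        have := Submodule.finrank_lt this.ne
        omega
      obtain ⟨C₁, hC₁, hgrow⟩ := hφp.norm_sub_pow_le hd hφc Z hZ hR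
      obtain ⟨L, hL, hLip⟩ := ConvexOn.exists_lipschitz_closedBall hf R
      set R' := R + L * (2 * R) with hR'
      have hRR' : R ≤ R' := by rw [hR']; nlinarith [mul_pos hL hR]
      obtain ⟨C₂, hC₂, hind⟩ := ih Z hZlt ι (fun i x => f i x)
        (fun i => (hf i).comp_linearMap Z.subtype) (fun i => (hp i).comp_subtype Z) h0 R'
        (hR.trans_le hRR')
      set A := (2 * R) ^ (D - d) * (C₁ * C) with hA
      set B := C₂ ^ d * (2 ^ (d - 1) * (R ^ (d - 1) + L ^ d * (C₁ * C))) with hB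
      refine ⟨2 ^ (D - 1) * (A + B), by positivity, fun x ε hx hε hεR hfx => ?_⟩
      set w := Z.starProjection x with hw
      have hwn : ‖w‖ ≤ R := (Submodule.norm_starProjection_apply_le Z x).trans hx
      have hr2 : ‖x - w‖ ≤ 2 * R := (norm_sub_le _ _).trans (by linarith)
      have hrd : ‖x - w‖ ^ d ≤ C₁ * C * ε := by
        refine (hgrow x hx).trans ?_
        rw [mul_assoc]
        exact mul_le_mul_of_nonneg_left (hφ' x ε hε hfx) hC₁.le
      obtain ⟨y, hyS, hy⟩ := hind ⟨w, Submodule.starProjection_apply_mem Z x⟩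
        (ε + L * ‖x - w‖) (hwn.trans hRR') (by positivity) (by rw [hR']; gcongr) (fun i => by
          have := hLip i w x hwn hx
          rw [norm_sub_rev] at this
          have h2 := hfx i
          show f i w ≤ _
          linarith)
      refine ⟨y, hyS, ?_⟩
      have hy' : ‖w - y‖ ^ d ^ N ≤ C₂ * (ε + L * ‖x - w‖) := hy
      have hdD : d ≤ D := by
        rw [hD, pow_succ]; exact Nat.le_mul_of_pos_left _ (pow_pos hd _)
      have h1 : ‖x - w‖ ^ D ≤ A * ε := by
        rw [← Nat.sub_add_cancel hdD, pow_add, hA, mul_assoc]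
        gcongr
      have h2 : ‖w - y‖ ^ D ≤ B * ε := by
        rw [hD, pow_succ, pow_mul]
        calc (‖w - y‖ ^ d ^ N) ^ d ≤ (C₂ * (ε + L * ‖x - w‖)) ^ d := by gcongr
          _ = C₂ ^ d * (ε + L * ‖x - w‖) ^ d := mul_pow _ _ _
          _ ≤ C₂ ^ d * (2 ^ (d - 1) * (ε ^ d + (L * ‖x - w‖) ^ d)) := by
            gcongr; exact add_pow_le hε (by positivity) d
          _ ≤ C₂ ^ d * (2 ^ (d - 1) * (R ^ (d - 1) * ε + L ^ d * (C₁ * C * ε))) := by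
            have h3 : ε ^ d ≤ R ^ (d - 1) * ε := by
              obtain ⟨e, rfl⟩ := Nat.exists_eq_succ_of_ne_zero hd.ne'
              rw [pow_succ, Nat.succ_sub_one]; gcongr
            rw [mul_pow]; gcongr
          _ = B * ε := by rw [hB]; ring
      calc ‖x - y‖ ^ D ≤ (‖x - w‖ + ‖w - y‖) ^ D := by
            gcongr; exact norm_sub_le_norm_sub_add_norm_sub _ _ _
        _ ≤ 2 ^ (D - 1) * (‖x - w‖ ^ D + ‖w - y‖ ^ D) :=
          add_pow_le (norm_nonneg _) (norm_nonneg _) D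
        _ ≤ 2 ^ (D - 1) * (A * ε + B * ε) := by gcongr
        _ = _ := by ring

theorem exists_pow_mul_le_of_le_sub {u : ℕ → ℝ} {c : ℝ} {q : ℕ} (hq : 0 < q) (hc : 0 < c)
    (hu : ∀ k, 0 ≤ u k) (hrec : ∀ k, u (k + 1) ≤ u k - c * u k ^ (q + 1)) :
    ∃ K > 0, ∀ k : ℕ, u k ^ q * (k + 1) ≤ K := by
  refine ⟨max c⁻¹ (u 0 ^ q), lt_max_of_lt_left (inv_pos.mpr hc), fun k => ?_⟩
  set K := max c⁻¹ (u 0 ^ q) with hK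
  have hcK : 1 ≤ c * K := by
    calc 1 = c * c⁻¹ := (mul_inv_cancel₀ hc.ne').symm
      _ ≤ c * K := by gcongr; exact le_max_left _ _
  have hK0 : 0 < K := lt_max_of_lt_left (inv_pos.mpr hc)
  induction k with
  | zero => simp [hK]
  | succ k ih =>
    push_cast
    set w := u k ^ q with hw
    have hw0 : 0 ≤ w := pow_nonneg (hu k) q
    have hk : (0 : ℝ) ≤ k := Nat.cast_nonneg k
    have hrec' : u (k + 1) ≤ u k * (1 - c * w) := by
      refine (hrec k).trans_eq ?_
      rw [hw, pow_succ]; ring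
    have hle : u (k + 1) ≤ u k := hrec'.trans (by
      nlinarith [hu k, mul_nonneg (hu k) (mul_nonneg hc.le hw0)])
    by_cases hcase : w * (k + 1 + 1) ≤ K
    · refine le_trans ?_ hcase
      have : u (k + 1) ^ q ≤ w := pow_le_pow_left₀ (hu _) hle q
      gcongr
    · push Not at hcase
      rcases eq_or_lt_of_le (hu k) with h0 | hpos
      · rw [hw, ← h0, zero_pow hq.ne'] at hcase
        linarith
      have h1 : 0 ≤ 1 - c * w := by
        by_contra! hneg
        nlinarith [hu (k + 1), mul_neg_of_pos_of_neg hpos hneg]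
      have h2 : u (k + 1) ^ q ≤ w * (1 - c * w) := by
        calc u (k + 1) ^ q ≤ (u k * (1 - c * w)) ^ q := pow_le_pow_left₀ (hu _) hrec' q
          _ = w * (1 - c * w) ^ q := mul_pow _ _ _
          _ ≤ w * (1 - c * w) := by
            gcongr
            exact pow_le_of_le_one h1 (by nlinarith) hq.ne'
      have h3 : (1 - c * w) * (k + 1 + 1) ≤ k + 1 := by
        have : c * K ≤ c * (w * (k + 1 + 1)) := by gcongr
        linarith
      calc u (k + 1) ^ q * (k + 1 + 1) ≤ w * (1 - c * w) * (k + 1 + 1) := by gcongr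
        _ = w * ((1 - c * w) * (k + 1 + 1)) := by ring
        _ ≤ w * (k + 1) := by gcongr
        _ ≤ K := ih

/-- A Fejér monotone sequence whose decrease controls a power of the distance to the target set
converges, at a geometric rate or at a polynomial rate according to that power. -/
theorem exists_tendsto_rate_of_fejer {E : Type} [NormedAddCommGroup E] [ProperSpace E] {S : Set E}
    (hS : IsClosed S) (hne : S.Nonempty) {a : ℕ → E} {β : ℕ → ℝ} {C : ℝ} {q : ℕ} (hC : 0 < C)
    (hfej : ∀ k, ∀ e ∈ S, ‖a (k + 1) - e‖ ^ 2 + β k ^ 2 ≤ ‖a k - e‖ ^ 2)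
    (herr : ∀ k, infDist (a k) S ^ (q + 1) ≤ C * β k) :
    ∃ z ∈ S, Tendsto a atTop (nhds z) ∧ ∃ M > 0, ∃ r ∈ Ioo (0 : ℝ) 1, ∀ k : ℕ,
      (0 < q → ‖a k - z‖ ≤ M * ((k : ℝ) + 1) ^ (-(1 / (2 * (q : ℝ))))) ∧
      (q = 0 → ‖a k - z‖ ≤ M * r ^ (k + 1)) := by
  set δ : ℕ → ℝ := fun k => infDist (a k) S with hδ
  have hδ0 : ∀ k, 0 ≤ δ k := fun k => infDist_nonneg
  set c := (C⁻¹) ^ 2 with hc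
  have hc0 : 0 < c := by positivity
  have hnear : ∀ k, ∃ e ∈ S, δ k = ‖a k - e‖ := fun k => by
    obtain ⟨e, he, h⟩ := hS.exists_infDist_eq_dist hne (a k)
    exact ⟨e, he, by rw [← dist_eq_norm]; exact h⟩
  have hrec : ∀ k, δ (k + 1) ^ 2 ≤ δ k ^ 2 - c * (δ k ^ 2) ^ (q + 1) := by
    intro k
    obtain ⟨e, he, h⟩ := hnear k
    have h1 : δ (k + 1) ≤ ‖a (k + 1) - e‖ := by
      rw [← dist_eq_norm]; exact infDist_le_dist_of_mem he
    have h2 : δ (k + 1) ^ 2 ≤ ‖a (k + 1) - e‖ ^ 2 := pow_le_pow_left₀ (hδ0 _) h1 2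
    have h3 : c * (δ k ^ 2) ^ (q + 1) ≤ β k ^ 2 := by
      have h4 : C⁻¹ * δ k ^ (q + 1) ≤ β k := by
        rw [inv_mul_le_iff₀ hC]; exact herr k
      have h5 := pow_le_pow_left₀ (by have := hδ0 k; positivity) h4 2
      rwa [mul_pow, ← pow_mul, mul_comm (q + 1) 2, pow_mul] at h5
    have := hfej k e he
    rw [h]
    rw [h] at h3
    linarith
  have hanti : ∀ e ∈ S, ∀ k j, k ≤ j → ‖a j - e‖ ≤ ‖a k - e‖ := by
    intro e he k j hkj
    refine antitone_nat_of_succ_le (f := fun k => ‖a k - e‖) (fun k => ?_) hkj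
    have := hfej k e he
    exact (abs_le_of_sq_le_sq' (by nlinarith [sq_nonneg (β k)]) (norm_nonneg _)).2
  have hdist : ∀ k j, k ≤ j → dist (a k) (a j) ≤ 2 * δ k := by
    intro k j hkj
    obtain ⟨e, he, h⟩ := hnear k
    calc dist (a k) (a j) ≤ dist (a k) e + dist (a j) e := dist_triangle_right _ _ _
      _ ≤ 2 * δ k := by
        rw [dist_eq_norm, dist_eq_norm, h]
        linarith [hanti e he k j hkj]
  have hu0 : Tendsto (fun k => δ k ^ 2) atTop (nhds 0) := by
    have hmono : Antitone fun k => δ k ^ 2 := antitone_nat_of_succ_le fun k =>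
      (hrec k).trans (sub_le_self _ (by have := hδ0 k; positivity))
    have hbdd : BddBelow (range fun k => δ k ^ 2) := ⟨0, by rintro _ ⟨k, rfl⟩; positivity⟩
    have hlim := tendsto_atTop_ciInf hmono hbdd
    set ℓ := ⨅ k, δ k ^ 2
    have hℓ0 : 0 ≤ ℓ := le_ciInf fun k => by positivity
    have h1 : ℓ ≤ ℓ - c * ℓ ^ (q + 1) :=
      le_of_tendsto_of_tendsto' (hlim.comp (tendsto_add_atTop_nat 1))
        (hlim.sub ((hlim.pow (q + 1)).const_mul c)) hrec
    have h2 : ℓ ^ (q + 1) = 0 := le_antisymm (by nlinarith) (by positivity)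
    rwa [pow_eq_zero_iff (Nat.succ_ne_zero q) |>.mp h2] at hlim
  have hδlim : Tendsto δ atTop (nhds 0) := by
    have := hu0.sqrt
    simpa [Real.sqrt_sq (hδ0 _)] using this
  have h2δ : Tendsto (fun k => 2 * δ k) atTop (nhds 0) := by simpa using hδlim.const_mul 2
  have hcauchy : CauchySeq a := cauchySeq_of_le_tendsto_0' (fun k => 2 * δ k) hdist h2δ
  obtain ⟨z, hz⟩ := cauchySeq_tendsto_of_complete hcauchy
  have hzS : z ∈ S := by
    rw [hS.mem_iff_infDist_zero hne]
    exact tendsto_nhds_unique (((continuous_infDist_pt S).tendsto z).comp hz) hδlim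
  have hzd : ∀ k, ‖a k - z‖ ≤ 2 * δ k := by
    intro k
    rw [← dist_eq_norm]
    refine le_of_tendsto (tendsto_const_nhds.dist hz) ?_
    filter_upwards [eventually_ge_atTop k] with j hj using hdist k j hj
  refine ⟨z, hzS, hz, ?_⟩
  rcases Nat.eq_zero_or_pos q with rfl | hq
  · set r := √(max (1 - c) (1 / 4)) with hr
    have hmax : 0 < max (1 - c) (1 / 4) := lt_max_of_lt_right (by norm_num)
    have hr0 : 0 < r := Real.sqrt_pos.mpr hmax
    have hr1 : r < 1 := by
      rw [hr, Real.sqrt_lt' one_pos]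
      exact max_lt (by linarith) (by norm_num)
    have hstep : ∀ k, δ (k + 1) ≤ r * δ k := by
      intro k
      refine (abs_le_of_sq_le_sq' ?_ (by have := hδ0 k; positivity)).2
      rw [mul_pow, Real.sq_sqrt hmax.le]
      have h1 := hrec k
      have h2 := mul_le_mul_of_nonneg_right (le_max_left (1 - c) (1 / 4)) (sq_nonneg (δ k))
      simp only [zero_add, pow_one] at h1
      linarith
    have hgeo : ∀ k, δ k ≤ δ 0 * r ^ k := by
      intro k
      induction k with
      | zero => simp
      | succ k ih =>
        calc δ (k + 1) ≤ r * δ k := hstep k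
          _ ≤ r * (δ 0 * r ^ k) := by gcongr
          _ = _ := by ring
    have h00 := hδ0 0
    refine ⟨(2 * δ 0 + 1) / r, by positivity, r, ⟨hr0, hr1⟩, fun k =>
      ⟨fun h => absurd h (lt_irrefl 0), fun _ => (hzd k).trans ?_⟩⟩
    rw [pow_succ, div_mul_eq_mul_div, le_div_iff₀ hr0, ← mul_assoc]
    refine mul_le_mul_of_nonneg_right ?_ hr0.le
    have h1 := hgeo k
    have h2 : 0 < r ^ k := by positivity
    nlinarith
  · obtain ⟨K, hK, hKu⟩ := exists_pow_mul_le_of_le_sub hq hc0 (fun k => sq_nonneg (δ k)) hrec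
    set s : ℝ := 1 / (2 * (q : ℝ)) with hs
    have hq' : (0 : ℝ) < q := by exact_mod_cast hq
    refine ⟨2 * K ^ s, by positivity, 1 / 2, ⟨by norm_num, by norm_num⟩, fun k =>
      ⟨fun _ => (hzd k).trans ?_, fun h => absurd h hq.ne'⟩⟩
    rw [mul_assoc]
    gcongr
    have hk : (0 : ℝ) < k + 1 := by positivity
    have h1 : δ k ^ (2 * q) ≤ K / (k + 1) := by
      rw [le_div_iff₀ hk, pow_mul]; exact hKu k
    have h2 : δ k = (δ k ^ (2 * q)) ^ s := by
      rw [← Real.rpow_natCast, ← Real.rpow_mul (hδ0 k), hs]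
      push_cast
      rw [mul_one_div_cancel (by positivity), Real.rpow_one]
    rw [h2, Real.rpow_neg hk.le, ← div_eq_mul_inv, ← Real.div_rpow hK.le hk.le]
    have := hδ0 k
    exact Real.rpow_le_rpow (by positivity) h1 (by positivity)

theorem inner_le_zero_of_forall_dist_le {E : Type} [NormedAddCommGroup E] [InnerProductSpace ℝ E]
    {K : Set E} (hK : Convex ℝ K) {x p : E} (hp : p ∈ K) (hmin : ∀ y ∈ K, dist x p ≤ dist x y) :
    ∀ y ∈ K, inner ℝ (x - p) (y - p) ≤ 0 := by
  refine (norm_eq_iInf_iff_real_inner_le_zero hK hp).mp (le_antisymm ?_ ?_)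
  · have : Nonempty K := ⟨⟨p, hp⟩⟩
    exact le_ciInf fun y => by simpa [dist_eq_norm] using hmin y y.2
  · exact ciInf_le ⟨0, by rintro _ ⟨y, rfl⟩; exact norm_nonneg _⟩ (⟨p, hp⟩ : K)

theorem norm_sub_sq_add_le_of_inner_nonneg {E : Type} [NormedAddCommGroup E]
    [InnerProductSpace ℝ E] {x p e : E} (h : 0 ≤ inner ℝ (x - p) (p - e)) :
    ‖p - e‖ ^ 2 + ‖x - p‖ ^ 2 ≤ ‖x - e‖ ^ 2 := by
  have : x - e = (x - p) + (p - e) := by abel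
  rw [this, norm_add_sq_real]
  linarith

theorem two_mul_pow_le_pow_add_one {x : ℝ} (hx : 1 ≤ x) (n : ℕ) :
    2 * x ^ n ≤ (2 * x - 1) ^ n + 1 := by
  induction n with
  | zero => norm_num
  | succ n ih =>
    have h1 : 1 ≤ x ^ n := one_le_pow₀ hx
    rw [pow_succ, pow_succ]
    nlinarith [mul_nonneg (sub_nonneg.mpr h1) (sub_nonneg.mpr hx)]

/-- Convergence rate of the alternating projection algorithm in the possibly
infeasible case (Theorem 4.10). -/
theorem alternating_projection_rate_infeasible
    (n m l d : ℕ) (hn : 0 < n) (hm : 0 < m) (hl : 0 < l) (hd : 0 < d)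
    (g : Fin m → EuclideanSpace ℝ (Fin n) → ℝ)
    (h : Fin l → EuclideanSpace ℝ (Fin n) → ℝ)
    (hgpoly : ∀ i, ∃ p : MvPolynomial (Fin n) ℝ, p.totalDegree ≤ d ∧
      ∀ x : EuclideanSpace ℝ (Fin n), g i x = MvPolynomial.eval (fun t => x t) p)
    (hhpoly : ∀ j, ∃ p : MvPolynomial (Fin n) ℝ, p.totalDegree ≤ d ∧
      ∀ x : EuclideanSpace ℝ (Fin n), h j x = MvPolynomial.eval (fun t => x t) p)
    (hgconv : ∀ i, ConvexOn ℝ Set.univ (g i))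
    (hhconv : ∀ j, ConvexOn ℝ Set.univ (h j))
    (A B : Set (EuclideanSpace ℝ (Fin n)))
    (hA : A = {x | ∀ i, g i x ≤ 0}) (hB : B = {x | ∀ j, h j x ≤ 0})
    (hAne : A.Nonempty) (hBne : B.Nonempty)
    -- `v` is the nearest point of `B - A` to the origin
    (v : EuclideanSpace ℝ (Fin n))
    (hv : v ∈ B - A ∧ ∀ w ∈ B - A, ‖v‖ ≤ ‖w‖)
    -- the alternating projection sequences: `a (k+1)` is the nearest point of `A`
    -- to `b k`, and `b (k+1)` is the nearest point of `B` to `a (k+1)`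
    (a b : ℕ → EuclideanSpace ℝ (Fin n))
    (ha : ∀ k : ℕ, a (k + 1) ∈ A ∧ ∀ y ∈ A, dist (b k) (a (k + 1)) ≤ dist (b k) y)
    (hb : ∀ k : ℕ, b (k + 1) ∈ B ∧
      ∀ y ∈ B, dist (a (k + 1)) (b (k + 1)) ≤ dist (a (k + 1)) y)
    (ρ : ℝ)
    (hρ : ρ = 1 / min ((2 * (d : ℝ) - 1) ^ n - 1)
                      (2 * (Nat.choose (n - 1) ((n - 1) / 2) : ℝ) * (d : ℝ) ^ n - 2)) :
    ∃ atil ∈ A, ∃ btil ∈ B, btil - atil = v ∧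
      Tendsto a atTop (nhds atil) ∧ Tendsto b atTop (nhds btil) ∧
      ∃ M > (0 : ℝ), ∃ r₀ ∈ Set.Ioo (0 : ℝ) 1, ∀ k : ℕ, 1 ≤ k →
        (1 < d → ‖a k - atil‖ ≤ M * (k : ℝ) ^ (-ρ) ∧ ‖b k - btil‖ ≤ M * (k : ℝ) ^ (-ρ)) ∧
        (d = 1 → ‖a k - atil‖ ≤ M * r₀ ^ k ∧ ‖b k - btil‖ ≤ M * r₀ ^ k) := by
  have hgp : ∀ i, PolynomialOnLines d (g i) := fun i => by
    obtain ⟨p, hp, h⟩ := hgpoly i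
    exact .of_mvPolynomial p hp h
  have hhp : ∀ j, PolynomialOnLines d (h j) := fun j => by
    obtain ⟨p, hp, h⟩ := hhpoly j
    exact .of_mvPolynomial p hp h
  have hAconv : Convex ℝ A := by
    rw [hA, ofPred_forall]
    exact convex_iInter fun i => by simpa using (hgconv i).convex_le 0
  have hBconv : Convex ℝ B := by
    rw [hB, ofPred_forall]
    exact convex_iInter fun j => by simpa using (hhconv j).convex_le 0
  have hAcl : IsClosed A := by
    rw [hA, ofPred_forall]
    exact isClosed_iInter fun i =>
      isClosed_le (hgconv i).locallyLipschitz.continuous continuous_const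
  have hBcl : IsClosed B := by
    rw [hB, ofPred_forall]
    exact isClosed_iInter fun j =>
      isClosed_le (hhconv j).locallyLipschitz.continuous continuous_const
  have hmemA : ∀ x, x ∈ A ↔ ∀ i, g i x ≤ 0 := fun x => by rw [hA]; rfl
  have hmemB : ∀ x, x ∈ B ↔ ∀ j, h j x ≤ 0 := fun x => by rw [hB]; rfl
  obtain ⟨hvmem, hvmin⟩ := hv
  obtain ⟨s₁, hs₁, s, hs, hvs⟩ := Set.mem_sub.mp hvmem
  have hsv : s + v ∈ B := by rw [← hvs, add_sub_cancel]; exact hs₁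
  set S : Set (EuclideanSpace ℝ (Fin n)) := {e | e ∈ A ∧ e + v ∈ B} with hS
  have hSne : S.Nonempty := ⟨s, hs, hsv⟩
  have hScl : IsClosed S := hAcl.inter (hBcl.preimage (by fun_prop))
  have hinA : ∀ e ∈ S, ∀ x ∈ A, inner ℝ v (x - e) ≤ 0 := by
    intro e he x hx
    have := inner_le_zero_of_forall_dist_le hAconv (x := e + v) he.1 (fun y hy => by
      rw [dist_eq_norm, dist_eq_norm, add_sub_cancel_left]
      exact hvmin _ (Set.sub_mem_sub he.2 hy)) x hx
    rwa [add_sub_cancel_left] at this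
  have hinB : ∀ e ∈ S, ∀ y ∈ B, 0 ≤ inner ℝ v (y - (e + v)) := by
    intro e he y hy
    have := inner_le_zero_of_forall_dist_le hBconv (x := e) he.2 (fun y hy => by
      rw [dist_comm, dist_comm e, dist_eq_norm, dist_eq_norm, add_sub_cancel_left]
      exact hvmin _ (Set.sub_mem_sub hy he.1)) y hy
    rw [sub_add_cancel_left, inner_neg_left] at this
    linarith
  have hstepA : ∀ k, ∀ e ∈ S,
      ‖a (k + 1) - e‖ ^ 2 + ‖(b k - v) - a (k + 1)‖ ^ 2 ≤ ‖(b k - v) - e‖ ^ 2 := by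
    intro k e he
    apply norm_sub_sq_add_le_of_inner_nonneg
    have h1 := inner_le_zero_of_forall_dist_le hAconv (ha k).1 (ha k).2 e he.1
    have h2 := hinA e he _ (ha k).1
    rw [← neg_sub (a (k + 1)) e, inner_neg_right] at h1
    rw [sub_right_comm, inner_sub_left]
    linarith
  have hstepB : ∀ k, ∀ e ∈ S, ‖(b (k + 1) - v) - e‖ ^ 2 + ‖a (k + 1) - (b (k + 1) - v)‖ ^ 2 ≤
      ‖a (k + 1) - e‖ ^ 2 := by
    intro k e he
    apply norm_sub_sq_add_le_of_inner_nonneg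
    have h1 := inner_le_zero_of_forall_dist_le hBconv (hb k).1 (hb k).2 (e + v) he.2
    have h2 := hinB e he _ (hb k).1
    rw [← neg_sub (b (k + 1)) (e + v), inner_neg_right] at h1
    rw [sub_sub, add_comm v e, ← sub_add, inner_add_left]
    linarith
  have hBle : ∀ k, ∀ e ∈ S, ‖(b (k + 1) - v) - e‖ ≤ ‖a (k + 1) - e‖ := fun k e he =>
    (abs_le_of_sq_le_sq' (by nlinarith [hstepB k e he, sq_nonneg ‖a (k + 1) - (b (k + 1) - v)‖])
      (norm_nonneg _)).2
  set β : ℕ → ℝ := fun k => ‖a (k + 1) - (b (k + 1) - v)‖ with hβ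
  have hfej : ∀ k, ∀ e ∈ S, ‖a (k + 1 + 1) - e‖ ^ 2 + β k ^ 2 ≤ ‖a (k + 1) - e‖ ^ 2 := by
    intro k e he
    have h1 := hstepA (k + 1) e he
    have h2 := hstepB k e he
    nlinarith [sq_nonneg ‖(b (k + 1) - v) - a (k + 1 + 1)‖]
  set R₀ := ‖a 1 - s‖ with hR₀
  have hbound : ∀ k, ‖a (k + 1) - s‖ ≤ R₀ := by
    intro k
    induction k with
    | zero => exact le_rfl
    | succ k ih =>
      refine le_trans (abs_le_of_sq_le_sq' ?_ (norm_nonneg _)).2 ih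
      nlinarith [hfej k s ⟨hs, hsv⟩, sq_nonneg (β k)]
  set F : Fin m ⊕ Fin l → EuclideanSpace ℝ (Fin n) → ℝ :=
    Sum.elim (fun i x => g i (x + s)) (fun j x => h j (x + (s + v))) with hF
  have hFconv : ∀ i, ConvexOn ℝ univ (F i) := by
    rintro (i | j)
    · exact (hgconv i).translate_left s
    · exact (hhconv j).translate_left (s + v)
  have hFpoly : ∀ i, PolynomialOnLines d (F i) := by
    rintro (i | j)
    · exact (hgp i).comp_add s
    · exact (hhp j).comp_add (s + v)
  have hF0 : ∀ i, F i 0 ≤ 0 := by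
    rintro (i | j)
    · simpa [hF] using (hmemA s).mp hs i
    · simpa [hF] using (hmemB _).mp hsv j
  obtain ⟨L, hL, hLip⟩ := ConvexOn.exists_lipschitz_closedBall hFconv R₀
  have hR₀0 : 0 ≤ R₀ := norm_nonneg _
  obtain ⟨C, hC, herr⟩ := ConvexOn.exists_holder_error_bound hd n (EuclideanSpace ℝ (Fin n))
    (by simp) (Fin m ⊕ Fin l) F hFconv hFpoly hF0 (R₀ + L * R₀ + 1) (by positivity)
  obtain ⟨q, hq⟩ : ∃ q, d ^ n = q + 1 := ⟨d ^ n - 1, (Nat.sub_add_cancel (pow_pos hd n)).symm⟩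
  have hdist : ∀ k, infDist (a (k + 1)) S ^ (q + 1) ≤ C * L * β k := by
    intro k
    have hβ0 : 0 ≤ β k := norm_nonneg _
    have hβR : β k ≤ R₀ := by
      refine le_trans (abs_le_of_sq_le_sq' ?_ (norm_nonneg _)).2 (hbound k)
      nlinarith [hstepB k s ⟨hs, hsv⟩, sq_nonneg ‖(b (k + 1) - v) - s‖]
    obtain ⟨y, hyS, hy⟩ := herr (a (k + 1) - s) (L * β k)
      ((hbound k).trans (by have := mul_nonneg hL.le hR₀0; linarith)) (by positivity)
      (by have := mul_le_mul_of_nonneg_left hβR hL.le; linarith) (by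
        rintro (i | j)
        · refine le_trans ?_ (mul_nonneg hL.le hβ0)
          simpa [hF] using (hmemA _).mp (ha k).1 i
        · have h1 := hLip (Sum.inr j) (a (k + 1) - s) (b (k + 1) - v - s) (hbound k)
            ((hBle k s ⟨hs, hsv⟩).trans (hbound k))
          rw [sub_sub_sub_cancel_right] at h1
          have h2 : F (Sum.inr j) (b (k + 1) - v - s) ≤ 0 := by
            have h3 : b (k + 1) - v - s + (s + v) = b (k + 1) := by abel
            simp only [hF, Sum.elim_inr, h3]
            exact (hmemB _).mp (hb k).1 j
          simp only [hβ]
          linarith)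
    have hyS' : y + s ∈ S := by
      refine ⟨(hmemA _).mpr fun i => hyS (Sum.inl i), (hmemB _).mpr fun j => ?_⟩
      rw [add_assoc]
      exact hyS (Sum.inr j)
    rw [hq] at hy
    calc infDist (a (k + 1)) S ^ (q + 1) ≤ ‖a (k + 1) - s - y‖ ^ (q + 1) := by
          refine pow_le_pow_left₀ infDist_nonneg ?_ _
          rw [sub_sub, add_comm s y, ← dist_eq_norm]
          exact infDist_le_dist_of_mem hyS'
      _ ≤ C * (L * β k) := hy
      _ = C * L * β k := by ring
  obtain ⟨z, hzS, hz, M, hM, r, hr, hrate⟩ := exists_tendsto_rate_of_fejer hScl hSne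
    (a := fun k => a (k + 1)) (β := β) (mul_pos hC hL) hfej hdist
  have hbz : ∀ k, ‖b (k + 1) - (z + v)‖ ≤ ‖a (k + 1) - z‖ := fun k => by
    rw [add_comm z v, ← sub_sub]; exact hBle k z hzS
  have ha' : Tendsto a atTop (nhds z) := (tendsto_add_atTop_iff_nat 1).mp hz
  refine ⟨z, hzS.1, z + v, hzS.2, add_sub_cancel_left _ _, ha', ?_, M, hM, r, hr, ?_⟩
  · refine (tendsto_add_atTop_iff_nat 1).mp (tendsto_iff_norm_sub_tendsto_zero.mpr ?_)
    exact squeeze_zero (fun k => norm_nonneg _) hbz (tendsto_iff_norm_sub_tendsto_zero.mp hz)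
  · intro k hk
    obtain ⟨k, rfl⟩ := Nat.exists_eq_succ_of_ne_zero (Nat.one_le_iff_ne_zero.mp hk)
    suffices hsuff : (1 < d → ‖a (k + 1) - z‖ ≤ M * ((k + 1 : ℕ) : ℝ) ^ (-ρ)) ∧
        (d = 1 → ‖a (k + 1) - z‖ ≤ M * r ^ (k + 1)) from
      ⟨fun h1 => ⟨hsuff.1 h1, (hbz k).trans (hsuff.1 h1)⟩,
        fun h1 => ⟨hsuff.2 h1, (hbz k).trans (hsuff.2 h1)⟩⟩
    refine ⟨fun hd1 => ?_, fun hd1 => (hrate k).2 ?_⟩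
    · have hq0 : 0 < q := by
        have := Nat.one_lt_pow hn.ne' hd1
        omega
      refine ((hrate k).1 hq0).trans ?_
      push_cast
      gcongr
      · linarith [Nat.cast_nonneg (α := ℝ) k]
      have hq' : (0 : ℝ) < q := by exact_mod_cast hq0
      have hqd : (d : ℝ) ^ n = q + 1 := by exact_mod_cast hq
      have hβ1 : (1 : ℝ) ≤ Nat.choose (n - 1) ((n - 1) / 2) := by
        exact_mod_cast Nat.choose_pos (Nat.div_le_self _ _)
      rw [hρ]
      refine one_div_le_one_div_of_le (by positivity) (le_min ?_ ?_)
      · have := two_mul_pow_le_pow_add_one (x := (d : ℝ)) (by exact_mod_cast hd) n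
        linarith
      · rw [hqd]
        nlinarith
    · rw [hd1, one_pow] at hq
      omega
end
end

section
/- Let D_1, …, D_m ⊆ ℝ^n be nonempty closed convex sets with D := ⋂_{i=1}^m D_i nonempty, let x_0 ∈ ℝ^n, and let (x_k) be the sequence of cyclic projections onto D_1, …, D_m starting at x_0, with α_k := (k mod m) + 1 the index used at step k. Then for every k ≥ 0: dist(x_k, D)^2 − dist(x_{k+1}, D)^2 ≥ dist(x_k, D_{α_k})^2. -/
open Metric Set Filter
open scoped BigOperators

noncomputable section

/-- If `p` is a nearest point to `u` in a convex set `K`, then for every `w ∈ K` the angle at `p`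
is obtuse, so `dist u p ^ 2 + dist p w ^ 2 ≤ dist u w ^ 2`. -/
theorem dist_sq_add_dist_sq_le_of_nearest {E : Type*} [NormedAddCommGroup E]
    [InnerProductSpace ℝ E] {K : Set E} (hK : Convex ℝ K) {u p : E} (hp : p ∈ K)
    (hmin : ∀ y ∈ K, dist u p ≤ dist u y) {w : E} (hw : w ∈ K) :
    dist u p ^ 2 + dist p w ^ 2 ≤ dist u w ^ 2 := by
  have hinf : ‖u - p‖ = ⨅ y : K, ‖u - y‖ := by
    have : Nonempty K := ⟨⟨p, hp⟩⟩
    refine le_antisymm (le_ciInf fun y => ?_) ?_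
    · simpa only [dist_eq_norm] using hmin y y.2
    · exact ciInf_le (f := fun y : K => ‖u - y‖)
        ⟨0, by rintro _ ⟨y, rfl⟩; exact norm_nonneg _⟩ ⟨p, hp⟩
  have hinner := (norm_eq_iInf_iff_real_inner_le_zero hK hp).1 hinf w hw
  have hsq := norm_sub_sq_real (u - p) (w - p)
  rw [sub_sub_sub_cancel_right] at hsq
  rw [dist_eq_norm, dist_comm p w, dist_eq_norm, dist_eq_norm]
  linarith

/-- Key decrease estimate of cyclic projections (inequality (4.2) in the proof of
Proposition 4.2). -/
theorem cyclic_projection_decrease_estimate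
    (n m : ℕ) (hm : 0 < m)
    (D : Fin m → Set (EuclideanSpace ℝ (Fin n)))
    (hDne : ∀ i, (D i).Nonempty) (hDcl : ∀ i, IsClosed (D i))
    (hDcv : ∀ i, Convex ℝ (D i))
    (hne : (⋂ i, D i).Nonempty)
    -- the sequence of cyclic projections: `x (k+1)` is the nearest point of
    -- `D (k % m)` to `x k`
    (x : ℕ → EuclideanSpace ℝ (Fin n))
    (hx : ∀ k : ℕ, x (k + 1) ∈ D ⟨k % m, Nat.mod_lt k hm⟩ ∧
      ∀ y ∈ D ⟨k % m, Nat.mod_lt k hm⟩, dist (x k) (x (k + 1)) ≤ dist (x k) y) :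
    ∀ k : ℕ,
      Metric.infDist (x k) (⋂ i, D i) ^ 2 - Metric.infDist (x (k + 1)) (⋂ i, D i) ^ 2 ≥
        Metric.infDist (x k) (D ⟨k % m, Nat.mod_lt k hm⟩) ^ 2 := by
  intro k
  obtain ⟨hp, hmin⟩ := hx k
  obtain ⟨y, hy, hdist⟩ := (isClosed_iInter hDcl).exists_infDist_eq_dist hne (x k)
  have hpyth := dist_sq_add_dist_sq_le_of_nearest (hDcv _) hp hmin (mem_iInter.1 hy _)
  have hnext := pow_le_pow_left₀ infDist_nonneg (infDist_le_dist_of_mem (x := x (k + 1)) hy) 2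
  have hstep := pow_le_pow_left₀ infDist_nonneg (infDist_le_dist_of_mem (x := x k) hp) 2
  rw [hdist]
  linarith
end
end
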